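/- Let C ≤ F_q^n be a linear code with locality r, dimension k, and minimum distance d, and let t ≥ 0 be an integer with rt < k. Then there exists a linear code over F_q of length n − t(r+1), dimension at least k − rt, and minimum distance at least d. (Consequently, k ≤ rt + k_opt^{(q)}(n − t(r+1), d), where k_opt^{(q)}(m,d) is the largest possible dimension of a linear code over F_q of length m and minimum distance at least d.) -/

import Mathlib

/-- `C` has locality `r`: every coordinate `i` has a recovery set of size at most `r`. -/
def HasLocality {F : Type} [Field F] {n : ℕ} (C : Submodule F (Fin n → F)) (r : ℕ) : Prop :=
  ∀ i : Fin n, ∃ S : Finset (Fin n), i ∉ S ∧ S.card ≤ r ∧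
    ∀ x ∈ C, ∀ y ∈ C, (∀ j ∈ S, x j = y j) → x i = y i

/-- `d` is the minimum Hamming distance of the linear code `C`. -/
def IsMinDist {F : Type} [Field F] [DecidableEq F] {n : ℕ}
    (C : Submodule F (Fin n → F)) (d : ℕ) : Prop :=
  (∀ x ∈ C, x ≠ 0 → d ≤ hammingNorm x) ∧ ∃ x ∈ C, x ≠ 0 ∧ hammingNorm x = d

/-- The vectors of `F^n` that vanish on the coordinates in `A`. -/
def vanishingOn (F : Type) [Field F] {n : ℕ} (A : Finset (Fin n)) : Submodule F (Fin n → F) :=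
  LinearMap.ker (LinearMap.funLeft F F (Subtype.val : A → Fin n))

theorem mem_vanishingOn {F : Type} [Field F] {n : ℕ} {A : Finset (Fin n)} {x : Fin n → F} :
    x ∈ vanishingOn F A ↔ ∀ i ∈ A, x i = 0 := by
  simp [vanishingOn, funext_iff, LinearMap.funLeft_apply]

theorem finrank_le_finrank_inf_vanishingOn_add_card {F : Type} [Field F] {n : ℕ}
    (C : Submodule F (Fin n → F)) (A : Finset (Fin n)) :
    Module.finrank F C ≤ Module.finrank F ↥(C ⊓ vanishingOn F A) + A.card := by
  set f := (LinearMap.funLeft F F (Subtype.val : A → Fin n)).domRestrict C with hf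
  have hrank := f.finrank_range_add_finrank_ker
  have hrange : Module.finrank F (LinearMap.range f) ≤ A.card := by
    simpa using Submodule.finrank_le (LinearMap.range f)
  have hker : Module.finrank F ↥(C ⊓ vanishingOn F A) = Module.finrank F (LinearMap.ker f) := by
    rw [← Submodule.map_comap_subtype, Submodule.finrank_map_subtype_eq]
    rfl
  omega

/-- A nonzero vector of the shortened code at `U` has a nonzero coordinate `i` outside `U`;
a recovery set of `i` is then enlarged to exactly `r` coordinates outside `U ∪ {i}`. -/
theorem exists_card_eq_and_finrank_le {F : Type} [Field F] {n : ℕ}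
    (C : Submodule F (Fin n → F)) (r : ℕ) (hloc : HasLocality C r) (t : ℕ)
    (ht : r * t < Module.finrank F C) :
    ∃ U : Finset (Fin n), U.card = t * (r + 1) ∧
      Module.finrank F C ≤ Module.finrank F ↥(C ⊓ vanishingOn F U) + r * t := by
  induction t with
  | zero => exact ⟨∅, by simp, by simpa using finrank_le_finrank_inf_vanishingOn_add_card C ∅⟩
  | succ t ih =>
    rw [Nat.mul_succ] at ht
    obtain ⟨U, hU, hdim⟩ := ih (by omega)
    have hpos : C ⊓ vanishingOn F U ≠ ⊥ := by
      intro h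
      rw [h, finrank_bot] at hdim
      omega
    obtain ⟨x, hx, hx0⟩ := Submodule.exists_mem_ne_zero_of_ne_bot hpos
    obtain ⟨i, hi⟩ := Function.ne_iff.mp hx0
    have hiU : i ∉ U := fun h => hi (mem_vanishingOn.mp hx.2 i h)
    obtain ⟨S, hiS, hS, hrec⟩ := hloc i
    have recover {y : Fin n → F} (hy : y ∈ C) (h : ∀ j ∈ S, y j = 0) : y i = 0 :=
      hrec y hy 0 C.zero_mem h
    have hbot : (C ⊓ vanishingOn F U) ⊓ vanishingOn F (insert i U)ᶜ = ⊥ := by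
      rw [eq_bot_iff]
      rintro y ⟨⟨hyC, hyU⟩, hyA⟩
      replace hyU := mem_vanishingOn.mp hyU
      replace hyA := mem_vanishingOn.mp hyA
      have hne (j : Fin n) (hj : j ≠ i) : y j = 0 := by
        by_cases hjU : j ∈ U
        · exact hyU j hjU
        · exact hyA j (by simp [hj, hjU])
      refine (Submodule.mem_bot F).mpr (funext fun j => ?_)
      by_cases hj : j = i
      · rw [hj]
        exact recover hyC fun l hl => hne l (ne_of_mem_of_not_mem hl hiS)
      · exact hne j hj
    have hcard := finrank_le_finrank_inf_vanishingOn_add_card (C ⊓ vanishingOn F U) (insert i U)ᶜ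
    rw [hbot, finrank_bot] at hcard
    have hsub : S \ U ⊆ (insert i U)ᶜ := by
      intro j hj
      obtain ⟨hjS, hjU⟩ := Finset.mem_sdiff.mp hj
      simp [hjU, ne_of_mem_of_not_mem hjS hiS]
    obtain ⟨T, hST, hTA, hT⟩ := Finset.exists_subsuperset_card_eq hsub
      ((Finset.card_le_card Finset.sdiff_subset).trans hS) (by omega : r ≤ _)
    have hdisj : Disjoint (insert i U) T :=
      (Finset.subset_compl_iff_disjoint_left).mp hTA
    refine ⟨insert i U ∪ T, ?_, ?_⟩
    · rw [Finset.card_union_of_disjoint hdisj, Finset.card_insert_of_notMem hiU, hU, hT]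
      ring
    · have hle : (C ⊓ vanishingOn F U) ⊓ vanishingOn F T ≤
          C ⊓ vanishingOn F (insert i U ∪ T) := by
        rintro y ⟨⟨hyC, hyU⟩, hyT⟩
        replace hyU := mem_vanishingOn.mp hyU
        replace hyT := mem_vanishingOn.mp hyT
        refine ⟨hyC, mem_vanishingOn.mpr fun j hj => ?_⟩
        rcases Finset.mem_union.mp hj with hj | hj
        · rcases Finset.mem_insert.mp hj with rfl | hj
          · refine recover hyC fun l hl => ?_
            by_cases hlU : l ∈ U
            · exact hyU l hlU
            · exact hyT l (hST (Finset.mem_sdiff.mpr ⟨hl, hlU⟩))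
          · exact hyU j hj
        · exact hyT j hj
      have hmono := Submodule.finrank_mono hle
      have hstep := finrank_le_finrank_inf_vanishingOn_add_card (C ⊓ vanishingOn F U) T
      rw [hT] at hstep
      rw [Nat.mul_succ]
      omega

theorem hammingNorm_le_hammingNorm_comp {F : Type} [Field F] [DecidableEq F] {n m : ℕ}
    (e : Fin m → Fin n) {x : Fin n → F} (hx : ∀ i ∉ Set.range e, x i = 0) :
    hammingNorm x ≤ hammingNorm (x ∘ e) := by
  classical
  refine (Finset.card_le_card fun i hi => ?_).trans
    (Finset.card_image_le (f := e) (s := Finset.univ.filter fun j => (x ∘ e) j ≠ 0))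
  have hi : x i ≠ 0 := by simpa using hi
  obtain ⟨j, rfl⟩ := not_imp_comm.mp (hx i) hi
  exact Finset.mem_image_of_mem e (by simpa using hi)

/-- Shortening bound (existence form): if `C ≤ F_q^n` has locality `r`, dimension `k` and
minimum distance `d`, and `t ≥ 0` satisfies `r·t < k`, then there exists a linear code over
`F_q` of length `n - t(r+1)`, dimension at least `k - r·t`, and minimum distance at least `d`. -/
theorem stmt_3 {F : Type} [Field F] [Fintype F] [DecidableEq F] {n : ℕ}
    (C : Submodule F (Fin n → F)) (hC : C ≠ ⊥)
    (r k d t : ℕ) (hloc : HasLocality C r)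
    (hk : Module.finrank F C = k) (hd : IsMinDist C d) (ht : r * t < k) :
    ∃ D : Submodule F (Fin (n - t * (r + 1)) → F), D ≠ ⊥ ∧
      k - r * t ≤ Module.finrank F D ∧
      ∀ x ∈ D, x ≠ 0 → d ≤ hammingNorm x := by
  subst hk
  obtain ⟨U, hU, hdim⟩ := exists_card_eq_and_finrank_le C r hloc t ht
  have hUc : Uᶜ.card = n - t * (r + 1) := by rw [Finset.card_compl, Fintype.card_fin, hU]
  set e : Fin (n - t * (r + 1)) → Fin n := ⇑(Uᶜ.orderEmbOfFin hUc)
  have hrange : Set.range e = ↑Uᶜ := Finset.range_orderEmbOfFin _ hUc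
  have hzero {x : Fin n → F} (hx : x ∈ C ⊓ vanishingOn F U) : ∀ i ∉ Set.range e, x i = 0 := by
    intro i hi
    exact mem_vanishingOn.mp hx.2 i (by simpa [hrange] using hi)
  let f := (LinearMap.funLeft F F e).domRestrict (C ⊓ vanishingOn F U)
  have hf : Function.Injective f := by
    rw [← LinearMap.ker_eq_bot, LinearMap.ker_eq_bot']
    rintro ⟨x, hx⟩ hfx
    ext i
    by_cases hi : i ∈ Set.range e
    · obtain ⟨j, rfl⟩ := hi
      exact congrFun hfx j
    · exact hzero hx i hi
  have hrank : Module.finrank F (LinearMap.range f) =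
      Module.finrank F ↥(C ⊓ vanishingOn F U) := LinearMap.finrank_range_of_inj hf
  refine ⟨LinearMap.range f, fun h => ?_, by omega, ?_⟩
  · rw [h, finrank_bot] at hrank
    omega
  · rintro _ ⟨⟨x, hx⟩, rfl⟩ hne
    refine (hd.1 x hx.1 ?_).trans (hammingNorm_le_hammingNorm_comp e (hzero hx))
    rintro rfl
    exact hne (map_zero f)
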